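/- arXiv:2512.10773 — 3 statements merged into one kernel-verified Lean document; each statement's English description precedes it below -/
import Mathlib

section
/- Let d : ℕ and let E = EuclideanSpace ℝ (Fin d). Let M̄, Λ : E →L[ℝ] E be symmetric continuous linear maps, and suppose there are constants λΛ > 0 and μM > 0 such that ⟪x, Λ x⟫ ≥ λΛ·‖x‖² and ⟪x, M̄ x⟫ ≤ μM·‖x‖² for all x ∈ E. Let ν > 0 and σm ≥ 0. Let s : ℝ → E and σ̂ : ℝ → ℝ be differentiable on [0,∞), and let σ : ℝ → E satisfy ‖σ(t)‖ ≤ σm for all t ≥ 0. Assume that for every t ≥ 0: (i) M̄ (s'(t)) = -Λ (s(t)) + σ(t) - σ̂(t) • u(s(t)), and (ii) σ̂'(t) = ‖s(t)‖ - ν·σ̂(t). Define V(t) = (1/2)·⟪s(t), M̄ (s(t))⟫ + (1/2)·(σ̂(t) - σm)², ρ = min(λΛ, ν/2) / max(μM/2, 1/2), and δ = (ν/2)·σm². Then for every κ with 0 < κ < ρ and every t ≥ 0, V(t) ≤ max (V(0)) (δ/(ρ - κ)). In particular the closed-loop trajectories are uniformly ultimately bounded. -/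
open RealInnerProductSpace

-- Unit-direction map: `u s = s / ‖s‖` if `s ≠ 0`, and `0` otherwise.
open scoped Classical in
noncomputable def udir {d : ℕ} (s : EuclideanSpace ℝ (Fin d)) : EuclideanSpace ℝ (Fin d) :=
  if s = 0 then 0 else ‖s‖⁻¹ • s

lemma real_inner_udir_right {d : ℕ} (s : EuclideanSpace ℝ (Fin d)) : ⟪s, udir s⟫ = ‖s‖ := by
  unfold udir
  split_ifs with h
  · simp [h]
  · have : ‖s‖ ≠ 0 := norm_ne_zero_iff.mpr h
    rw [real_inner_smul_right, real_inner_self_eq_norm_sq]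
    field_simp

/-- If the right derivative of `V` is negative wherever `V` exceeds both `V 0` and `B`, then `V` never
exceeds the larger of the two. -/
lemma le_max_of_deriv_right_neg {V V' : ℝ → ℝ} {B : ℝ}
    (hV : ∀ t ∈ Set.Ici (0 : ℝ), HasDerivWithinAt V (V' t) (Set.Ici 0) t)
    (hneg : ∀ t ≥ (0 : ℝ), B < V t → V' t < 0) {t : ℝ} (ht : 0 ≤ t) :
    V t ≤ max (V 0) B := by
  refine le_of_forall_pos_le_add fun ε hε => ?_
  refine image_le_of_deriv_right_lt_deriv_boundary' (a := 0) (b := t) (f' := V')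
    (B := fun _ => max (V 0) B + ε) (B' := fun _ => 0)
    (fun x hx => (hV x hx.1).continuousWithinAt.mono Set.Icc_subset_Ici_self)
    (fun x hx => (hV x hx.1).mono (Set.Ici_subset_Ici.mpr hx.1))
    (by linarith [le_max_left (V 0) B]) continuousOn_const
    (fun x _ => hasDerivWithinAt_const _ _ _) (fun x hx hx' => hneg x hx.1 ?_) ⟨ht, le_rfl⟩
  linarith [le_max_right (V 0) B]

lemma HasDerivWithinAt.half_inner_clm_self {E : Type*} [NormedAddCommGroup E]
    [InnerProductSpace ℝ E] {A : E →L[ℝ] E} (hA : ∀ x y : E, ⟪A x, y⟫ = ⟪x, A y⟫)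
    {s : ℝ → E} {v : E} {S : Set ℝ} {t : ℝ} (hs : HasDerivWithinAt s v S t) :
    HasDerivWithinAt (fun t => (1 / 2) * ⟪s t, A (s t)⟫) ⟪s t, A v⟫ S t := by
  refine ((hs.inner ℝ (A.hasFDerivAt.comp_hasDerivWithinAt t hs)).const_mul (1 / 2)).congr_deriv ?_
  rw [Function.comp_apply, ← hA v, real_inner_comm (s t) (A v)]
  ring

/-- Theorem 2.2 (UUB): under the closed-loop dynamics
`M̄ ṡ = -Λ s + σ - σ̂ u(s)` and the adaptive law `σ̂' = ‖s‖ - ν σ̂`,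
the Lyapunov function `V = (1/2)⟪s, M̄ s⟫ + (1/2)(σ̂ - σm)²` satisfies
`V t ≤ max (V 0) (δ/(ρ - κ))` for all `t ≥ 0` and every `0 < κ < ρ`. -/
theorem stmt0 {d : ℕ}
    (Mbar Lam : EuclideanSpace ℝ (Fin d) →L[ℝ] EuclideanSpace ℝ (Fin d))
    (hMsym : ∀ x y : EuclideanSpace ℝ (Fin d), ⟪Mbar x, y⟫ = ⟪x, Mbar y⟫)
    (hLsym : ∀ x y : EuclideanSpace ℝ (Fin d), ⟪Lam x, y⟫ = ⟪x, Lam y⟫)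
    (lamL muM : ℝ) (hlamL : 0 < lamL) (hmuM : 0 < muM)
    (hLam : ∀ x : EuclideanSpace ℝ (Fin d), lamL * ‖x‖ ^ 2 ≤ ⟪x, Lam x⟫)
    (hMub : ∀ x : EuclideanSpace ℝ (Fin d), ⟪x, Mbar x⟫ ≤ muM * ‖x‖ ^ 2)
    (ν σm : ℝ) (hν : 0 < ν) (hσm : 0 ≤ σm)
    (s : ℝ → EuclideanSpace ℝ (Fin d)) (s' : ℝ → EuclideanSpace ℝ (Fin d))
    (sighat sighat' : ℝ → ℝ)
    (hs : ∀ t ∈ Set.Ici (0 : ℝ), HasDerivWithinAt s (s' t) (Set.Ici 0) t)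
    (hsighat : ∀ t ∈ Set.Ici (0 : ℝ), HasDerivWithinAt sighat (sighat' t) (Set.Ici 0) t)
    (σ : ℝ → EuclideanSpace ℝ (Fin d)) (hσ : ∀ t ≥ (0 : ℝ), ‖σ t‖ ≤ σm)
    (hdyn : ∀ t ≥ (0 : ℝ), Mbar (s' t) = -Lam (s t) + σ t - sighat t • udir (s t))
    (hadapt : ∀ t ≥ (0 : ℝ), sighat' t = ‖s t‖ - ν * sighat t)
    (V : ℝ → ℝ)
    (hV : V = fun t => (1 / 2) * ⟪s t, Mbar (s t)⟫ + (1 / 2) * (sighat t - σm) ^ 2)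
    (ρ δ : ℝ)
    (hρ : ρ = min lamL (ν / 2) / max (muM / 2) (1 / 2))
    (hδ : δ = (ν / 2) * σm ^ 2)
    (κ : ℝ) (hκ : 0 < κ) (hκρ : κ < ρ) :
    ∀ t ≥ (0 : ℝ), V t ≤ max (V 0) (δ / (ρ - κ)) := by
  intro t ht
  refine le_max_of_deriv_right_neg
    (V' := fun t => ⟪s t, Mbar (s' t)⟫ + (sighat t - σm) * sighat' t) (fun t ht => ?_)
    (fun t ht hBV => ?_) ht
  · rw [hV]
    refine ((hs t ht).half_inner_clm_self hMsym).add
      (((((hsighat t ht).sub_const σm).pow 2).const_mul (1 / 2)).congr_deriv ?_)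
    norm_num
    ring
  · have hgap : 0 < ρ - κ := sub_pos.mpr hκρ
    have hδ0 : 0 ≤ δ := by rw [hδ]; positivity
    have hB0 : 0 ≤ δ / (ρ - κ) := div_nonneg hδ0 hgap.le
    have hσs : ⟪s t, σ t⟫ ≤ ‖s t‖ * σm :=
      (real_inner_le_norm _ _).trans (mul_le_mul_of_nonneg_left (hσ t ht) (norm_nonneg _))
    have hLs := hLam (s t)
    have hMs := hMub (s t)
    simp only [hdyn t ht, hadapt t ht, inner_sub_right, inner_add_right, inner_neg_right,
      real_inner_smul_right, real_inner_udir_right]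
    have hW : V t = (1 / 2) * ⟪s t, Mbar (s t)⟫ + (1 / 2) * (sighat t - σm) ^ 2 := by rw [hV]
    set W := V t
    set m := max (muM / 2) (1 / 2)
    have hm : 0 < m := lt_max_of_lt_right (by norm_num)
    have hWm : W ≤ m * (‖s t‖ ^ 2 + (sighat t - σm) ^ 2) := by
      nlinarith [mul_le_mul_of_nonneg_right (le_max_left (muM / 2) (1 / 2)) (sq_nonneg ‖s t‖),
        mul_le_mul_of_nonneg_right (le_max_right (muM / 2) (1 / 2)) (sq_nonneg (sighat t - σm))]
    have hρW : ρ * W ≤ lamL * ‖s t‖ ^ 2 + ν / 2 * (sighat t - σm) ^ 2 := by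
      have hρm : ρ * m = min lamL (ν / 2) := by rw [hρ]; field_simp
      calc ρ * W ≤ ρ * (m * (‖s t‖ ^ 2 + (sighat t - σm) ^ 2)) :=
            mul_le_mul_of_nonneg_left hWm (hκ.trans hκρ).le
        _ = min lamL (ν / 2) * ‖s t‖ ^ 2 + min lamL (ν / 2) * (sighat t - σm) ^ 2 := by
            rw [← mul_assoc, hρm, mul_add]
        _ ≤ _ := by
            gcongr
            · exact min_le_left _ _
            · exact min_le_right _ _
    have hδW : δ < (ρ - κ) * W := by rwa [div_lt_iff₀' hgap] at hBV
    have hκW : 0 < κ * W := mul_pos hκ (hB0.trans_lt hBV)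
    nlinarith [mul_nonneg hν.le (sq_nonneg (sighat t))]
end

section
/- Let d : ℕ and let E = EuclideanSpace ℝ (Fin d). Let M̄, Λ : E →L[ℝ] E be symmetric continuous linear maps with constants λΛ > 0 and μM > 0 such that ⟪x, Λ x⟫ ≥ λΛ·‖x‖² and ⟪x, M̄ x⟫ ≤ μM·‖x‖² for all x ∈ E. Let ν > 0, σm ≥ 0, let s : ℝ → E and σ̂ : ℝ → ℝ be differentiable, and σ : ℝ → E with ‖σ(t)‖ ≤ σm for all t. Assume for all t: M̄ (s'(t)) = -Λ (s(t)) + σ(t) - σ̂(t) • u(s(t)) and σ̂'(t) = ‖s(t)‖ - ν·σ̂(t). Define V(t) = (1/2)·⟪s(t), M̄ (s(t))⟫ + (1/2)·(σ̂(t) - σm)², ρ = min(λΛ, ν/2) / max(μM/2, 1/2), and δ = (ν/2)·σm². Then V'(t) ≤ -ρ·V(t) + δ for all t. -/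
open RealInnerProductSpace

/-- Linear Lyapunov differential inequality `V' ≤ -ρ V + δ` with
`ρ = min(λΛ, ν/2) / max(μM/2, 1/2)` and `δ = (ν/2)σm²`. -/
theorem stmt5 {d : ℕ}
    (Mbar Lam : EuclideanSpace ℝ (Fin d) →L[ℝ] EuclideanSpace ℝ (Fin d))
    (hMsym : ∀ x y : EuclideanSpace ℝ (Fin d), ⟪Mbar x, y⟫ = ⟪x, Mbar y⟫)
    (hLsym : ∀ x y : EuclideanSpace ℝ (Fin d), ⟪Lam x, y⟫ = ⟪x, Lam y⟫)
    (lamL muM : ℝ) (hlamL : 0 < lamL) (hmuM : 0 < muM)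
    (hLam : ∀ x : EuclideanSpace ℝ (Fin d), lamL * ‖x‖ ^ 2 ≤ ⟪x, Lam x⟫)
    (hMub : ∀ x : EuclideanSpace ℝ (Fin d), ⟪x, Mbar x⟫ ≤ muM * ‖x‖ ^ 2)
    (ν σm : ℝ) (hν : 0 < ν) (hσm : 0 ≤ σm)
    (s s' : ℝ → EuclideanSpace ℝ (Fin d)) (sighat sighat' : ℝ → ℝ)
    (hs : ∀ t, HasDerivAt s (s' t) t)
    (hsighat : ∀ t, HasDerivAt sighat (sighat' t) t)
    (σ : ℝ → EuclideanSpace ℝ (Fin d)) (hσ : ∀ t, ‖σ t‖ ≤ σm)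
    (hdyn : ∀ t, Mbar (s' t) = -Lam (s t) + σ t - sighat t • udir (s t))
    (hadapt : ∀ t, sighat' t = ‖s t‖ - ν * sighat t)
    (V : ℝ → ℝ)
    (hV : V = fun t => (1 / 2) * ⟪s t, Mbar (s t)⟫ + (1 / 2) * (sighat t - σm) ^ 2)
    (ρ δ : ℝ)
    (hρ : ρ = min lamL (ν / 2) / max (muM / 2) (1 / 2))
    (hδ : δ = (ν / 2) * σm ^ 2) :
    ∀ t, deriv V t ≤ -ρ * V t + δ := by
  intro t
  have hVderiv : HasDerivAt V (⟪s t, Mbar (s' t)⟫ + (sighat t - σm) * sighat' t) t := by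
    have hMs : HasDerivAt (fun t => Mbar (s t)) (Mbar (s' t)) t :=
      Mbar.hasFDerivAt.comp_hasDerivAt t (hs t)
    have hquad := ((hs t).inner ℝ hMs).const_mul (1 / 2 : ℝ)
    have hsq := (((hsighat t).sub_const σm).pow 2).const_mul (1 / 2 : ℝ)
    rw [hV]
    refine (hquad.add hsq).congr_deriv ?_
    rw [← hMsym (s' t) (s t), real_inner_comm (s t) (Mbar (s' t))]
    push_cast
    ring
  have hu : ⟪s t, udir (s t)⟫ = ‖s t‖ := by
    unfold udir
    split_ifs with h
    · simp [h]
    · have hn : ‖s t‖ ≠ 0 := norm_ne_zero_iff.mpr h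
      rw [real_inner_smul_right, real_inner_self_eq_norm_sq]
      field_simp
  have hσs : ⟪s t, σ t⟫ ≤ ‖s t‖ * σm :=
    (real_inner_le_norm _ _).trans (mul_le_mul_of_nonneg_left (hσ t) (norm_nonneg _))
  have hinner : ⟪s t, Mbar (s' t)⟫ = -⟪s t, Lam (s t)⟫ + ⟪s t, σ t⟫ - sighat t * ‖s t‖ := by
    rw [hdyn, inner_sub_right, inner_add_right, inner_neg_right, real_inner_smul_right, hu]
  have hderiv : deriv V t ≤
      -(lamL * ‖s t‖ ^ 2 + ν / 2 * (sighat t - σm) ^ 2) + δ := by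
    rw [hVderiv.deriv, hinner, hadapt, hδ]
    nlinarith [hLam (s t), mul_nonneg hν.le (sq_nonneg (sighat t))]
  have hmax : 0 < max (muM / 2) (1 / 2) := lt_max_of_lt_right (by norm_num)
  have hmin : 0 ≤ min lamL (ν / 2) := le_min hlamL.le (by positivity)
  have hVle : V t ≤ max (muM / 2) (1 / 2) * (‖s t‖ ^ 2 + (sighat t - σm) ^ 2) := by
    have h1 := mul_le_mul_of_nonneg_right (le_max_left (muM / 2) (1 / 2)) (sq_nonneg ‖s t‖)
    have h2 := mul_le_mul_of_nonneg_right (le_max_right (muM / 2) (1 / 2))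
      (sq_nonneg (sighat t - σm))
    simp only [hV]
    linarith [hMub (s t)]
  have hρV : ρ * V t ≤ min lamL (ν / 2) * (‖s t‖ ^ 2 + (sighat t - σm) ^ 2) := by
    rw [hρ, div_mul_eq_mul_div, div_le_iff₀ hmax]
    linarith [mul_le_mul_of_nonneg_left hVle hmin]
  have h1 := mul_le_mul_of_nonneg_right (min_le_left lamL (ν / 2)) (sq_nonneg ‖s t‖)
  have h2 := mul_le_mul_of_nonneg_right (min_le_right lamL (ν / 2))
    (sq_nonneg (sighat t - σm))
  linarith
end

section
/- Let d : ℕ and let E = EuclideanSpace ℝ (Fin d). Let Φ : E →L[ℝ] E satisfy ⟪x, Φ x⟫ ≥ φ·‖x‖² for all x ∈ E with φ > 0. Let e : ℝ → E be differentiable on [0,∞) and s : ℝ → E satisfy e'(t) = s(t) - Φ (e(t)) and ‖s(t)‖ ≤ c for all t ≥ 0, where c ≥ 0. Then ‖e(t)‖ ≤ max (‖e(0)‖) (c/φ) for all t ≥ 0. -/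
open RealInnerProductSpace

/-- UUB of the tracking error: if `ė = s - Φ e` with `Φ` positive definite
(`⟪x, Φ x⟫ ≥ φ‖x‖²`, `φ > 0`) and `‖s t‖ ≤ c` for `t ≥ 0`, then
`‖e t‖ ≤ max ‖e 0‖ (c/φ)` for all `t ≥ 0`. -/
theorem stmt9 {d : ℕ}
    (Phi : EuclideanSpace ℝ (Fin d) →L[ℝ] EuclideanSpace ℝ (Fin d))
    (φ : ℝ) (hφ : 0 < φ)
    (hPhi : ∀ x : EuclideanSpace ℝ (Fin d), φ * ‖x‖ ^ 2 ≤ ⟪x, Phi x⟫)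
    (e e' s : ℝ → EuclideanSpace ℝ (Fin d))
    (he : ∀ t ∈ Set.Ici (0 : ℝ), HasDerivWithinAt e (e' t) (Set.Ici 0) t)
    (heq : ∀ t ≥ (0 : ℝ), e' t = s t - Phi (e t))
    (c : ℝ) (hc : 0 ≤ c) (hs : ∀ t ≥ (0 : ℝ), ‖s t‖ ≤ c) :
    ∀ t ≥ (0 : ℝ), ‖e t‖ ≤ max (‖e 0‖) (c / φ) := by
  intro t ht
  refine le_of_forall_gt_imp_ge_of_dense fun M hM => ?_
  obtain ⟨h0, hcM⟩ := max_lt_iff.mp hM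
  have hM0 : 0 < M := (norm_nonneg _).trans_lt h0
  rw [div_lt_iff₀ hφ] at hcM
  have hsq : ∀ x ∈ Set.Ici (0 : ℝ),
      HasDerivWithinAt (fun x => ‖e x‖ ^ 2) (2 * ⟪e x, e' x⟫) (Set.Ici 0) x :=
    fun x hx => (he x hx).norm_sq
  refine (sq_le_sq₀ (norm_nonneg _) hM0.le).mp ?_
  refine image_le_of_deriv_right_lt_deriv_boundary' (a := 0) (b := t)
    (f := fun x => ‖e x‖ ^ 2) (f' := fun x => 2 * ⟪e x, e' x⟫)
    (B := fun _ => M ^ 2) (B' := fun _ => 0)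
    (fun x hx => (hsq x hx.1).continuousWithinAt.mono Set.Icc_subset_Ici_self)
    (fun x hx => (hsq x hx.1).mono (Set.Ici_subset_Ici.mpr hx.1))
    (pow_le_pow_left₀ (norm_nonneg _) h0.le 2) continuousOn_const
    (fun x _ => hasDerivWithinAt_const _ _ _) ?_ (Set.right_mem_Icc.mpr ht)
  intro x hx hxM
  have hnorm : ‖e x‖ = M := (sq_eq_sq₀ (norm_nonneg _) hM0.le).mp hxM
  have hinner : ⟪e x, s x⟫ ≤ M * c := by
    calc ⟪e x, s x⟫ ≤ ‖e x‖ * ‖s x‖ := real_inner_le_norm _ _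
      _ ≤ M * c := by rw [hnorm]; gcongr; exact hs x hx.1
  have hcoercive := hPhi (e x)
  rw [hnorm] at hcoercive
  rw [heq x hx.1, inner_sub_right]
  nlinarith [mul_lt_mul_of_pos_left hcM hM0]
end
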